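/- arXiv:0905.4049 — 8 statements merged into one kernel-verified Lean document; each statement's English description precedes it below -/
import Mathlib

section
/- Let N be a positive integer and let a_1 < a_2 < ... < a_N be positive integers whose greatest common divisor is 1. Assume that for each pair of indices i, k in {1,...,N} there exists an index j in {1,...,N} such that a_k divides a_i + a_j. Then a_i = i for every i in {1,...,N}. -/
theorem eq_of_dvd_of_pos_of_lt_two_mul {m n : ℕ} (h : m ∣ n) (hn : 0 < n) (hlt : n < 2 * m) :
    n = m := by
  obtain ⟨c, rfl⟩ := h
  have hc : c < 2 := by
    by_contra! hc
    nlinarith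
  have : 0 < c := Nat.pos_of_mul_pos_left hn
  obtain rfl : c = 1 := by lia
  simp

/-- Every term other than the first remains a term after subtracting the first one. -/
theorem exists_add_first_eq {N : ℕ} {a : ℕ → ℕ}
    (hpos : ∀ i ∈ Finset.Icc 1 N, 0 < a i)
    (hmono : StrictMonoOn a (Finset.Icc 1 N))
    (hdiv : ∀ i ∈ Finset.Icc 1 N, ∀ k ∈ Finset.Icc 1 N,
      ∃ j ∈ Finset.Icc 1 N, a k ∣ a i + a j) :
    ∀ i ∈ Finset.Icc 1 N, 1 < i → ∃ j ∈ Finset.Icc 1 N, a j + a 1 = a i := by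
  intro i hi hi1
  have hiN := (Finset.mem_Icc.mp hi).2
  have h1 : 1 ∈ Finset.Icc 1 N := by simp; lia
  have hN : N ∈ Finset.Icc 1 N := by simp; lia
  have hP : N - 1 ∈ Finset.Icc 1 N := by simp; lia
  have le_of_le {p q : ℕ} (hp : p ∈ Finset.Icc 1 N) (hq : q ∈ Finset.Icc 1 N) (hpq : p ≤ q) :
      a p ≤ a q := hmono.monotoneOn hp hq hpq
  have lt_of_lt {p q : ℕ} (hp : p ∈ Finset.Icc 1 N) (hq : q ∈ Finset.Icc 1 N) (hpq : p < q) :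
      a p < a q := hmono hp hq hpq
  have reflect : ∀ p ∈ Finset.Icc 1 N, p < N →
      ∃ q ∈ Finset.Icc 1 N, q < N ∧ a p + a q = a N := by
    intro p hp hpN
    obtain ⟨q, hq, h⟩ := hdiv p hp N hN
    have hp0 := hpos p hp
    have hpN' := lt_of_lt hp hN hpN
    have hqN := le_of_le hq hN (Finset.mem_Icc.mp hq).2
    have hsum := eq_of_dvd_of_pos_of_lt_two_mul h (by lia) (by lia)
    refine ⟨q, hq, lt_of_le_of_ne (Finset.mem_Icc.mp hq).2 ?_, hsum⟩
    rintro rfl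
    lia
  have hlast : a (N - 1) + a 1 = a N := by
    obtain ⟨q, hq, hqN, hsum⟩ := reflect 1 h1 (by lia)
    obtain ⟨r, hr, hrN, hsum'⟩ := reflect (N - 1) hP (by lia)
    have := le_of_le hq hP (by lia)
    have := le_of_le h1 hr (Finset.mem_Icc.mp hr).1
    lia
  rcases hiN.eq_or_lt with rfl | hiN
  · exact ⟨_, hP, hlast⟩
  obtain ⟨p, hp, hpN, hsum⟩ := reflect i hi hiN
  have hi_gt := lt_of_lt h1 hi hi1
  have h1_le := le_of_le h1 hP (Finset.mem_Icc.mp hP).1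
  obtain ⟨q, hq, h⟩ := hdiv p hp (N - 1) hP
  have hp0 := hpos p hp
  rcases (Finset.mem_Icc.mp hq).2.eq_or_lt with rfl | hqN
  · have h' : a (q - 1) ∣ a p + a 1 := by
      rw [← hlast, show a p + (a (q - 1) + a 1) = a p + a 1 + a (q - 1) by ring] at h
      exact (Nat.dvd_add_left dvd_rfl).mp h
    have := eq_of_dvd_of_pos_of_lt_two_mul h' (by lia) (by lia)
    exact ⟨1, h1, by lia⟩
  · have := le_of_le hq hP (by lia)
    have := eq_of_dvd_of_pos_of_lt_two_mul h (by lia) (by lia)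
    exact ⟨q, hq, by lia⟩

/-- Lemma I: if `a 1 < a 2 < ... < a N` are positive integers that are relatively
prime, and for all indices `i, k` there is an index `j` with `a k ∣ a i + a j`,
then `a i = i` for all `i`. -/
theorem stmt_0 (N : ℕ) (hN : 0 < N) (a : ℕ → ℕ)
    (hpos : ∀ i ∈ Finset.Icc 1 N, 0 < a i)
    (hmono : ∀ i ∈ Finset.Icc 1 N, ∀ k ∈ Finset.Icc 1 N, i < k → a i < a k)
    (hgcd : (Finset.Icc 1 N).gcd a = 1)
    (hdiv : ∀ i ∈ Finset.Icc 1 N, ∀ k ∈ Finset.Icc 1 N,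
      ∃ j ∈ Finset.Icc 1 N, a k ∣ a i + a j) :
    ∀ i ∈ Finset.Icc 1 N, a i = i := by
  have hmonoOn : StrictMonoOn a (Finset.Icc 1 N) := fun i hi k hk hik => hmono i hi k hk hik
  have hsub := exists_add_first_eq hpos hmonoOn hdiv
  have h1 : 1 ∈ Finset.Icc 1 N := by simp; lia
  have hdvd : ∀ i ∈ Finset.Icc 1 N, a 1 ∣ a i := by
    intro i
    induction i using Nat.strong_induction_on with
    | _ i ih =>
      intro hi
      rcases (Finset.mem_Icc.mp hi).1.eq_or_lt with rfl | hi1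
      · exact dvd_rfl
      obtain ⟨j, hj, hsum⟩ := hsub i hi hi1
      have hji : j < i := (hmonoOn.lt_iff_lt hj hi).mp (by have := hpos 1 h1; lia)
      rw [← hsum]
      exact dvd_add (ih j hji hj) dvd_rfl
  have ha1 : a 1 = 1 := by
    have := Finset.dvd_gcd hdvd
    rwa [hgcd, Nat.dvd_one] at this
  intro i hi
  obtain ⟨hi1, hiN⟩ := Finset.mem_Icc.mp hi
  induction i, hi1 using Nat.le_induction with
  | base => exact ha1
  | succ i hi1 ih =>
    have hi' : i ∈ Finset.Icc 1 N := by simp; lia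
    obtain ⟨j, hj, hsum⟩ := hsub (i + 1) hi (by lia)
    have hji : j < i + 1 := (hmonoOn.lt_iff_lt hj hi).mp (by lia)
    have hle : a j ≤ a i := hmonoOn.monotoneOn hj hi' (by lia)
    have hlt := hmono i hi' (i + 1) hi (by lia)
    have := ih hi' (by lia)
    lia
end

section
/- Let N ≥ 2 be an integer and let a_1 < a_2 < ... < a_N be positive integers whose greatest common divisor is 1. Assume that for each pair of indices i, k in {1,...,N} there exists an index j in {1,...,N} such that a_k divides a_i + a_j. Then a_i + a_{N-i} = a_N for every i in {1,...,N-1}. -/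
/-- A strictly decreasing self-map of `{1, ..., N - 1}` is the reversal `i ↦ N - i`. -/
theorem eq_sub_of_strictAntiOn {N : ℕ} {f : ℕ → ℕ}
    (hf : ∀ i ∈ Finset.Icc 1 (N - 1), f i ∈ Finset.Icc 1 (N - 1))
    (hanti : ∀ i ∈ Finset.Icc 1 (N - 1), ∀ k ∈ Finset.Icc 1 (N - 1), i < k → f k < f i) :
    ∀ i ∈ Finset.Icc 1 (N - 1), f i = N - i := by
  simp only [Finset.mem_Icc] at *
  have upper : ∀ i, i + 1 ≤ N - 1 → f (i + 1) + (i + 1) ≤ N := by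
    intro i
    induction i with
    | zero => intro h; have := hf 1 ⟨le_rfl, h⟩; simp only [zero_add]; omega
    | succ i ih =>
      intro h
      have := ih (by omega)
      have := hanti (i + 1) (by omega) (i + 1 + 1) (by omega) (by omega)
      omega
  have lower : ∀ t, t + 1 ≤ N - 1 → t + 1 ≤ f (N - (t + 1)) := by
    intro t
    induction t with
    | zero => intro h; have := hf (N - 1) (by omega); simp only [zero_add]; omega
    | succ t ih =>
      intro h
      have := ih (by omega)
      have := hanti (N - (t + 1 + 1)) (by omega) (N - (t + 1)) (by omega) (by omega)
      omega
  intro i hi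
  have h₁ := upper (i - 1) (by omega)
  have h₂ := lower (N - i - 1) (by omega)
  rw [show i - 1 + 1 = i by omega] at h₁
  rw [show N - (N - i - 1 + 1) = i by omega] at h₂
  omega

/-- The key identity in the inductive step of Lemma I: under the hypotheses of
Lemma I with `N ≥ 2`, one has `a i + a (N - i) = a N` for all `i ∈ {1, ..., N-1}`. -/
theorem stmt_1 (N : ℕ) (hN : 2 ≤ N) (a : ℕ → ℕ)
    (hpos : ∀ i ∈ Finset.Icc 1 N, 0 < a i)
    (hmono : ∀ i ∈ Finset.Icc 1 N, ∀ k ∈ Finset.Icc 1 N, i < k → a i < a k)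
    (hgcd : (Finset.Icc 1 N).gcd a = 1)
    (hdiv : ∀ i ∈ Finset.Icc 1 N, ∀ k ∈ Finset.Icc 1 N,
      ∃ j ∈ Finset.Icc 1 N, a k ∣ a i + a j) :
    ∀ i ∈ Finset.Icc 1 (N - 1), a i + a (N - i) = a N := by
  have partner : ∀ i ∈ Finset.Icc 1 (N - 1), ∃ j ∈ Finset.Icc 1 (N - 1), a i + a j = a N := by
    simp only [Finset.mem_Icc] at *
    intro i hi
    obtain ⟨j, hj, hdvd⟩ := hdiv i (by omega) N (by omega)
    have hi₀ := hpos i (by omega)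
    have hiN := hmono i (by omega) N (by omega) (by omega)
    obtain rfl | hjN := eq_or_ne j N
    · have := Nat.le_of_dvd hi₀ ((Nat.dvd_add_left dvd_rfl).1 hdvd)
      omega
    · have hjN' := hmono j hj N (by omega) (by omega)
      refine ⟨j, by omega, Nat.eq_of_dvd_of_lt_two_mul (by omega) hdvd (by omega)⟩
  choose! f hf hsum using partner
  have hanti : ∀ i ∈ Finset.Icc 1 (N - 1), ∀ k ∈ Finset.Icc 1 (N - 1), i < k → f k < f i := by
    intro i hi k hk hik
    have hsi := hsum i hi
    have hsk := hsum k hk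
    have hfi := hf i hi
    have hfk := hf k hk
    simp only [Finset.mem_Icc] at *
    have haik := hmono i (by omega) k (by omega) hik
    by_contra! h
    obtain h | h := h.eq_or_lt
    · rw [h] at hsi
      omega
    · have := hmono (f i) (by omega) (f k) (by omega) h
      omega
  intro i hi
  rw [← eq_sub_of_strictAntiOn hf hanti i hi]
  exact hsum i hi
end

section
/- Let N be a positive integer and let W be a finite multiset of positive integers whose set of distinct elements is {a_1,...,a_N} with a_1 < ... < a_N, where a_i occurs in W with multiplicity m_i ≥ 1. Assume gcd(a_1,...,a_N) = 1, and assume W ≡ -W (mod a_i) for every i in {1,...,N}. If N = 3, then m_2 = m_1. -/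
/-- For a multiset `W` of natural numbers and a modulus `d`, the condition
`W ≡ -W (mod d)`: for every residue `r` modulo `d`, the number of elements of
`W` (with multiplicity) congruent to `r` equals the number congruent to `-r`.
This is expressed as: the multiset of residues of `W` modulo `d` is invariant
under negation. -/
def ModSymm (W : Multiset ℕ) (d : ℕ) : Prop :=
  W.map (fun x => ((x : ZMod d))) = W.map (fun x => (-(x : ZMod d)))

/-- A residue in the open interval `(0, c)` that is its own negative modulo `c` is `c / 2`. -/
theorem two_mul_eq_of_neg_natCast_eq_self {x c : ℕ} (hx : 0 < x) (hxc : x < c)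
    (h : -(x : ZMod c) = x) : 2 * x = c := by
  have h2 : ((2 * x : ℕ) : ZMod c) = 0 := by
    push_cast
    linear_combination -h
  obtain ⟨k, hk⟩ := (ZMod.natCast_eq_zero_iff _ _).1 h2
  have hk0 : 0 < k := by
    by_contra! hk0
    obtain rfl : k = 0 := by lia
    lia
  have hk2 : k < 2 := by
    by_contra! hk2
    nlinarith
  obtain rfl : k = 1 := by lia
  lia

/-- If a multiset supported on `x < y < c` is symmetric modulo `c`, and contains `x` and `y`, then
these occur equally often. -/
theorem ModSymm.eq_of_replicate {x y c p q r : ℕ} (hx : 0 < x) (hxy : x < y) (hyc : y < c)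
    (hp : 0 < p) (hq : 0 < q)
    (h : ModSymm (Multiset.replicate p x + Multiset.replicate q y + Multiset.replicate r c) c) :
    q = p := by
  have hne : ∀ {u : ℕ}, 0 < u → u < c → (u : ZMod c) ≠ 0 := fun hu huc h0 =>
    (Nat.le_of_dvd hu ((ZMod.natCast_eq_zero_iff _ _).1 h0)).not_gt huc
  have hx0 := hne hx (hxy.trans hyc)
  have hy0 := hne (hx.trans hxy) hyc
  have hxy' : (x : ZMod c) ≠ y := by
    intro h'
    have := (ZMod.natCast_eq_natCast_iff' _ _ _).1 h'
    rw [Nat.mod_eq_of_lt (hxy.trans hyc), Nat.mod_eq_of_lt hyc] at this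
    lia
  simp only [ModSymm, Multiset.bind_def, Multiset.pure_def, Multiset.bind_singleton,
    Multiset.map_add, Multiset.map_replicate] at h
  have h1 := congrArg (Multiset.count (x : ZMod c)) h
  have h2 := congrArg (Multiset.count (y : ZMod c)) h
  simp only [Multiset.count_add, Multiset.count_replicate, CharP.cast_eq_zero, neg_zero,
    hx0.symm, hy0.symm, hxy', hxy'.symm, if_true, if_false, add_zero,
    zero_add] at h1 h2
  by_cases hyx : -(y : ZMod c) = x
  · have hxx : -(x : ZMod c) ≠ x := fun h' => hxy' (neg_injective (h'.trans hyx.symm))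
    simp only [hyx, hxx, if_true, if_false, zero_add] at h1
    exact h1.symm
  · have hxy'' : -(x : ZMod c) ≠ y := fun h' => hyx (by rw [← h', neg_neg])
    simp only [hyx, hxy'', if_false, add_zero, zero_add] at h1 h2
    have hxx : -(x : ZMod c) = x := by
      by_contra h'
      rw [if_neg h'] at h1
      lia
    have hyy : -(y : ZMod c) = y := by
      by_contra h'
      rw [if_neg h'] at h2
      lia
    have := two_mul_eq_of_neg_natCast_eq_self hx (hxy.trans hyc) hxx
    have := two_mul_eq_of_neg_natCast_eq_self (hx.trans hxy) hyc hyy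
    lia

/-- Lemma II, claim (2): if `N = 3` then `m 2 = m 1`. -/
theorem stmt_3 (N : ℕ) (hN : 0 < N) (a m : ℕ → ℕ) (W : Multiset ℕ)
    (hpos : ∀ i ∈ Finset.Icc 1 N, 0 < a i)
    (hmono : ∀ i ∈ Finset.Icc 1 N, ∀ k ∈ Finset.Icc 1 N, i < k → a i < a k)
    (hmult : ∀ i ∈ Finset.Icc 1 N, 1 ≤ m i)
    (hcount : ∀ i ∈ Finset.Icc 1 N, W.count (a i) = m i)
    (hmem : ∀ x ∈ W, ∃ i ∈ Finset.Icc 1 N, x = a i)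
    (hgcd : (Finset.Icc 1 N).gcd a = 1)
    (hmod : ∀ i ∈ Finset.Icc 1 N, ModSymm W (a i))
    (hN3 : N = 3) :
    m 2 = m 1 := by
  subst hN3
  have h12 := hmono 1 (by simp) 2 (by simp) (by simp)
  have h23 := hmono 2 (by simp) 3 (by simp) (by simp)
  have hW : W = Multiset.replicate (m 1) (a 1) + Multiset.replicate (m 2) (a 2)
      + Multiset.replicate (m 3) (a 3) := by
    ext z
    simp only [Multiset.count_add, Multiset.count_replicate]
    by_cases hz : z ∈ W
    · obtain ⟨i, hi, rfl⟩ := hmem z hz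
      rw [hcount i hi]
      obtain ⟨hi1, hi3⟩ := Finset.mem_Icc.1 hi
      interval_cases i <;> simp [h12.ne, h12.ne', h23.ne, h23.ne', (h12.trans h23).ne,
        (h12.trans h23).ne']
    · have hne : ∀ i ∈ Finset.Icc 1 3, a i ≠ z := by
        rintro i hi rfl
        exact hz (Multiset.count_pos.1 (by rw [hcount i hi]; exact hmult i hi))
      simp [Multiset.count_eq_zero_of_notMem hz, hne 1, hne 2, hne 3]
  have hsymm := hmod 3 (by simp)
  rw [hW] at hsymm
  exact hsymm.eq_of_replicate (hpos 1 (by simp)) h12 h23 (hmult 1 (by simp)) (hmult 2 (by simp))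
end

section
/- Let N be a positive integer and let W be a finite multiset of positive integers whose set of distinct elements is {a_1,...,a_N} with a_1 < ... < a_N, where a_i occurs in W with multiplicity m_i ≥ 1. Assume gcd(a_1,...,a_N) = 1, and assume W ≡ -W (mod a_i) for every i in {1,...,N}. If N = 4, then m_3 = m_1 and m_2 = m_1 + m_4. -/
theorem natCast_zmod_eq_iff_of_lt {d x y : ℕ} (hx : x < d) (hy : y < d) :
    (x : ZMod d) = y ↔ x = y := by
  rw [ZMod.natCast_eq_natCast_iff', Nat.mod_eq_of_lt hx, Nat.mod_eq_of_lt hy]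

theorem neg_natCast_zmod_eq_iff_of_lt {d x y : ℕ} (hx0 : 0 < x) (hx : x < d) (hy : y < d) :
    -(x : ZMod d) = y ↔ x + y = d := by
  rw [neg_eq_iff_add_eq_zero, ← Nat.cast_add, ZMod.natCast_eq_zero_iff]
  constructor
  · rintro ⟨k, hk⟩
    have hk1 : k = 1 := by
      have h1 : 0 < k := Nat.pos_of_ne_zero (by rintro rfl; omega)
      have h2 : k < 2 := by
        by_contra! h
        have := Nat.mul_le_mul_left d h
        omega
      omega
    rw [hk, hk1, mul_one]
  · intro h
    rw [h]

theorem modSymm_iff_map_cast {W : Multiset ℕ} {d : ℕ} :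
    ModSymm W d ↔ W.map (fun x : ℕ => (x : ZMod d)) = W.map (fun x : ℕ => -(x : ZMod d)) := by
  simp [ModSymm, Multiset.bind_singleton, Multiset.map_map]

/-- Comparing the multiplicities of a residue `r` in a symmetric multiset with four values. -/
theorem ModSymm.sum_ite_eq {p q s t m₁ m₂ m₃ m₄ d : ℕ}
    (h : ModSymm (Multiset.replicate m₁ p + Multiset.replicate m₂ q +
      Multiset.replicate m₃ s + Multiset.replicate m₄ t) d) (r : ZMod d) :
    ((if (p : ZMod d) = r then m₁ else 0) + (if (q : ZMod d) = r then m₂ else 0) +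
      (if (s : ZMod d) = r then m₃ else 0) + (if (t : ZMod d) = r then m₄ else 0)) =
    ((if -(p : ZMod d) = r then m₁ else 0) + (if -(q : ZMod d) = r then m₂ else 0) +
      (if -(s : ZMod d) = r then m₃ else 0) + (if -(t : ZMod d) = r then m₄ else 0)) := by
  classical
  have h' := congrArg (Multiset.count r) (modSymm_iff_map_cast.mp h)
  simpa only [Multiset.map_add, Multiset.map_replicate, Multiset.count_add,
    Multiset.count_replicate] using h'

theorem ModSymm.sum_ite_eq_of_lt {p q s t m₁ m₂ m₃ m₄ d r : ℕ}
    (h : ModSymm (Multiset.replicate m₁ p + Multiset.replicate m₂ q +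
      Multiset.replicate m₃ s + Multiset.replicate m₄ t) d)
    (hp : 0 < p) (hpd : p < d) (hq : 0 < q) (hqd : q < d) (hs : 0 < s) (hsd : s < d)
    (ht : (t : ZMod d) = 0) (hr : 0 < r) (hrd : r < d) :
    ((if p = r then m₁ else 0) + (if q = r then m₂ else 0) + (if s = r then m₃ else 0)) =
    ((if p + r = d then m₁ else 0) + (if q + r = d then m₂ else 0) +
      (if s + r = d then m₃ else 0)) := by
  have h' := h.sum_ite_eq (r : ZMod d)
  have h0 : ¬ (0 : ZMod d) = r := by
    rw [eq_comm, ZMod.natCast_eq_zero_iff]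
    exact Nat.not_dvd_of_pos_of_lt hr hrd
  simpa only [ht, neg_zero, h0, if_false, add_zero, natCast_zmod_eq_iff_of_lt hpd hrd,
    natCast_zmod_eq_iff_of_lt hqd hrd, natCast_zmod_eq_iff_of_lt hsd hrd,
    neg_natCast_zmod_eq_iff_of_lt hp hpd hrd, neg_natCast_zmod_eq_iff_of_lt hq hqd hrd,
    neg_natCast_zmod_eq_iff_of_lt hs hsd hrd] using h'

/-- Symmetry modulo the largest of four values reverses the other three. -/
theorem ModSymm.reverse_of_largest {p q s t m₁ m₂ m₃ m₄ : ℕ}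
    (h : ModSymm (Multiset.replicate m₁ p + Multiset.replicate m₂ q +
      Multiset.replicate m₃ s + Multiset.replicate m₄ t) t)
    (hp : 0 < p) (hpq : p < q) (hqs : q < s) (hst : s < t)
    (h₁ : 0 < m₁) (h₂ : 0 < m₂) (h₃ : 0 < m₃) :
    p + s = t ∧ 2 * q = t ∧ m₃ = m₁ := by
  have key := fun r => h.sum_ite_eq_of_lt (r := r) hp (by omega) (by omega) (by omega)
    (by omega) hst (ZMod.natCast_self t)
  have e₁ := key p hp (by omega)
  have e₂ := key q (by omega) (by omega)
  have e₃ := key s (by omega) hst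
  have hps := hpq.trans hqs
  simp only [if_true, hpq.ne, hpq.ne', hqs.ne, hqs.ne', hps.ne, hps.ne', if_false, zero_add,
    add_zero, add_comm q p, add_comm s p, add_comm s q] at e₁ e₂ e₃
  clear key h
  by_cases hps' : p + s = t
  · split_ifs at e₁ e₂ e₃ <;> omega
  · split_ifs at e₁ e₂ e₃ <;> omega

/-- Symmetry modulo the third of four values whose first three are reversed by the fourth. -/
theorem ModSymm.mult_eq_of_third {p q s m₁ m₂ m₃ m₄ : ℕ}
    (h : ModSymm (Multiset.replicate m₁ p + Multiset.replicate m₂ q +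
      Multiset.replicate m₃ s + Multiset.replicate m₄ (p + s)) s)
    (hp : 0 < p) (hpq : p < q) (hqs : q < s) (hq : 2 * q = p + s) (h₂ : 0 < m₂) :
    m₂ = m₁ + m₄ := by
  have h' : ModSymm (Multiset.replicate m₁ p + Multiset.replicate m₂ q +
      Multiset.replicate m₄ p + Multiset.replicate m₃ s) s := by
    simp only [modSymm_iff_map_cast, Multiset.map_add, Multiset.map_replicate, Nat.cast_add,
      ZMod.natCast_self, add_zero] at h ⊢
    rwa [add_right_comm, add_right_comm (Multiset.replicate m₁ (-(p : ZMod s)) + _)]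
  have key := fun r => h'.sum_ite_eq_of_lt (r := r) hp (by omega) (by omega) hqs
    hp (by omega) (ZMod.natCast_self s)
  have e₁ := key p hp (by omega)
  have e₂ := key q (by omega) hqs
  grind

/-- Lemma II, claim (3): if `N = 4` then `m 3 = m 1` and `m 2 = m 1 + m 4`. -/
theorem stmt_4 (N : ℕ) (hN : 0 < N) (a m : ℕ → ℕ) (W : Multiset ℕ)
    (hpos : ∀ i ∈ Finset.Icc 1 N, 0 < a i)
    (hmono : ∀ i ∈ Finset.Icc 1 N, ∀ k ∈ Finset.Icc 1 N, i < k → a i < a k)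
    (hmult : ∀ i ∈ Finset.Icc 1 N, 1 ≤ m i)
    (hcount : ∀ i ∈ Finset.Icc 1 N, W.count (a i) = m i)
    (hmem : ∀ x ∈ W, ∃ i ∈ Finset.Icc 1 N, x = a i)
    (hgcd : (Finset.Icc 1 N).gcd a = 1)
    (hmod : ∀ i ∈ Finset.Icc 1 N, ModSymm W (a i))
    (hN4 : N = 4) :
    m 3 = m 1 ∧ m 2 = m 1 + m 4 := by
  subst hN4
  have hIcc : ∀ i, i ∈ Finset.Icc 1 4 ↔ i = 1 ∨ i = 2 ∨ i = 3 ∨ i = 4 := by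
    intro i
    rw [Finset.mem_Icc]
    omega
  simp only [hIcc, forall_eq_or_imp, forall_eq, exists_eq_or_imp, exists_eq_left]
    at hpos hmono hmult hcount hmem hmod
  have h12 : a 1 < a 2 := hmono.1.2.1 (by norm_num)
  have h23 : a 2 < a 3 := hmono.2.1.2.2.1 (by norm_num)
  have h34 : a 3 < a 4 := hmono.2.2.1.2.2.2 (by norm_num)
  have hW : W = Multiset.replicate (m 1) (a 1) + Multiset.replicate (m 2) (a 2) +
      Multiset.replicate (m 3) (a 3) + Multiset.replicate (m 4) (a 4) := by
    ext x
    simp only [Multiset.count_add, Multiset.count_replicate]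
    by_cases hx : x ∈ W
    · have := hmem x hx
      grind
    · have := Multiset.count_eq_zero_of_notMem hx
      grind
  rw [hW] at hmod
  obtain ⟨ht, hq, h31⟩ := hmod.2.2.2.reverse_of_largest hpos.1 h12 h23 h34
    hmult.1 hmult.2.1 hmult.2.2.1
  have h3 := hmod.2.2.1
  rw [← ht] at h3 hq
  exact ⟨h31, h3.mult_eq_of_third hpos.1 h12 h23 hq hmult.2.1⟩
end

section
/- Let N be a positive integer and let W be a finite multiset of positive integers whose set of distinct elements is {a_1,...,a_N} with a_1 < ... < a_N, where a_i occurs in W with multiplicity m_i ≥ 1. Assume gcd(a_1,...,a_N) = 1, and assume W ≡ -W (mod a_i) for every i in {1,...,N}. If N = 5, then m_4 = m_1, m_1 = 2·m_5, and m_3 = m_2 = 3·m_5. -/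
/-- In residues: `ModSymm` says that the weights of the classes of `c` and of `-c` agree. -/
lemma ModSymm.sum_eq {ι : Type*} {s : Finset ι} {a m : ι → ℕ} {d : ℕ}
    (h : ModSymm (∑ i ∈ s, m i • {a i}) d) {c : ℕ} (hc : c < d) :
    (∑ i ∈ s, if a i % d = c then m i else 0) =
      ∑ i ∈ s, if (a i + c) % d = 0 then m i else 0 := by
  have hmap : ∀ f : ℕ → ZMod d, (Multiset.map f (∑ i ∈ s, m i • {a i})).count (c : ZMod d) =
      ∑ i ∈ s, if f (a i) = c then m i else 0 := by
    intro f
    rw [← Multiset.coe_mapAddMonoidHom, map_sum, Multiset.count_sum']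
    refine Finset.sum_congr rfl fun i _ => ?_
    simp [Multiset.map_nsmul, Multiset.count_nsmul, Multiset.count_singleton, eq_comm]
  unfold ModSymm at h
  simp only [Multiset.bind_def, Multiset.pure_def, Multiset.bind_singleton, Multiset.map_map,
    Function.comp_def] at h
  have h' := congrArg (Multiset.count (c : ZMod d)) h
  rw [hmap, hmap] at h'
  convert h' using 3 with i _ i _
  · rw [ZMod.natCast_eq_natCast_iff', Nat.mod_eq_of_lt hc]
  · rw [neg_eq_iff_add_eq_zero, ← Nat.cast_add, ZMod.natCast_eq_zero_iff, Nat.dvd_iff_mod_eq_zero]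

/-- A multiset with distinct entries `a i` is the sum of its entries with multiplicity. -/
lemma Multiset.eq_sum_nsmul_singleton {ι α : Type*} [DecidableEq α] {s : Finset ι} {a : ι → α}
    {m : ι → ℕ} {W : Multiset α} (ha : Set.InjOn a s) (hcount : ∀ i ∈ s, W.count (a i) = m i)
    (hmem : ∀ x ∈ W, ∃ i ∈ s, x = a i) : W = ∑ i ∈ s, m i • {a i} := by
  ext x
  rw [Multiset.count_sum']
  simp only [Multiset.count_nsmul, Multiset.count_singleton, mul_ite, mul_one, mul_zero]
  by_cases hx : ∃ i ∈ s, x = a i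
  · obtain ⟨i, hi, rfl⟩ := hx
    rw [hcount i hi, Finset.sum_eq_single i, if_pos rfl]
    · exact fun j hj hji => if_neg fun e => hji (ha hj hi e.symm)
    · exact fun h => absurd hi h
  · rw [Multiset.count_eq_zero_of_notMem fun h => hx (hmem x h)]
    exact (Finset.sum_eq_zero fun i hi => if_neg fun e => hx ⟨i, hi, e⟩).symm

lemma Nat.add_mod_eq_zero_iff_of_lt {x y d : ℕ} (hx : 0 < x) (hxd : x < d) (hyd : y < d) :
    (x + y) % d = 0 ↔ x + y = d := by
  constructor
  · intro h
    obtain ⟨k, hk⟩ := Nat.dvd_of_mod_eq_zero h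
    have : k = 1 := by
      rcases k with _ | _ | k
      · omega
      · rfl
      · nlinarith
    subst this
    omega
  · rintro rfl
    exact Nat.mod_self _

/-- A symmetry `c ↦ s - c` of the weights on four points reverses their order. -/
lemma reflection_four {x y z w s p q r t : ℕ} (hx : 0 < x) (hxy : x < y) (hyz : y < z)
    (hzw : z < w) (hws : w < s) (hp : 0 < p) (hq : 0 < q) (hr : 0 < r) (ht : 0 < t)
    (h : ∀ c, 0 < c → c < s →
      (if x = c then p else 0) + (if y = c then q else 0) +
        (if z = c then r else 0) + (if w = c then t else 0) =
      (if x + c = s then p else 0) + (if y + c = s then q else 0) +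
        (if z + c = s then r else 0) + (if w + c = s then t else 0)) :
    x + w = s ∧ y + z = s ∧ t = p ∧ r = q := by
  have f1 := h x (by omega) (by omega)
  have f2 := h y (by omega) (by omega)
  have f3 := h z (by omega) (by omega)
  have f4 := h w (by omega) (by omega)
  clear h
  grind (splits := 40)

/-- A symmetry `c ↦ s - c` of the weights on three points reverses their order. -/
lemma reflection_three {x y z s p q r : ℕ} (hx : 0 < x) (hxy : x < y) (hyz : y < z)
    (hzs : z < s) (hp : 0 < p) (hq : 0 < q) (hr : 0 < r)
    (h : ∀ c, 0 < c → c < s →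
      (if x = c then p else 0) + (if y = c then q else 0) + (if z = c then r else 0) =
      (if x + c = s then p else 0) + (if y + c = s then q else 0) +
        (if z + c = s then r else 0)) :
    x + z = s ∧ y + y = s ∧ r = p := by
  have f1 := h x (by omega) (by omega)
  have f2 := h y (by omega) (by omega)
  have f3 := h z (by omega) (by omega)
  clear h
  grind (splits := 40)

/-- Lemma II, claim (4): if `N = 5` then `m 4 = m 1 = 2 m 5` and `m 3 = m 2 = 3 m 5`. -/
theorem stmt_5 (N : ℕ) (hN : 0 < N) (a m : ℕ → ℕ) (W : Multiset ℕ)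
    (hpos : ∀ i ∈ Finset.Icc 1 N, 0 < a i)
    (hmono : ∀ i ∈ Finset.Icc 1 N, ∀ k ∈ Finset.Icc 1 N, i < k → a i < a k)
    (hmult : ∀ i ∈ Finset.Icc 1 N, 1 ≤ m i)
    (hcount : ∀ i ∈ Finset.Icc 1 N, W.count (a i) = m i)
    (hmem : ∀ x ∈ W, ∃ i ∈ Finset.Icc 1 N, x = a i)
    (hgcd : (Finset.Icc 1 N).gcd a = 1)
    (hmod : ∀ i ∈ Finset.Icc 1 N, ModSymm W (a i))
    (hN5 : N = 5) :
    m 4 = m 1 ∧ m 1 = 2 * m 5 ∧ m 3 = m 2 ∧ m 2 = 3 * m 5 := by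
  subst hN5
  have hinj : Set.InjOn a (Finset.Icc 1 5 : Finset ℕ) := by
    intro i hi k hk e
    rcases lt_trichotomy i k with h | h | h
    · exact absurd e (hmono i hi k hk h).ne
    · exact h
    · exact absurd e (hmono k hk i hi h).ne'
  obtain rfl := Multiset.eq_sum_nsmul_singleton hinj hcount hmem
  have key : ∀ i ∈ Finset.Icc 1 5, ∀ c < a i,
      (∑ j ∈ Finset.Icc 1 5, if a j % a i = c then m j else 0) =
        ∑ j ∈ Finset.Icc 1 5, if (a j + c) % a i = 0 then m j else 0 :=
    fun i hi c hc => (hmod i hi).sum_eq hc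
  have h0 := hpos 1 (by simp)
  have h12 := hmono 1 (by simp) 2 (by simp) (by simp)
  have h23 := hmono 2 (by simp) 3 (by simp) (by simp)
  have h34 := hmono 3 (by simp) 4 (by simp) (by simp)
  have h45 := hmono 4 (by simp) 5 (by simp) (by simp)
  have m1 := hmult 1 (by simp)
  have m2 := hmult 2 (by simp)
  have m3 := hmult 3 (by simp)
  have m4 := hmult 4 (by simp)
  have hIcc : Finset.Icc 1 5 = ({1, 2, 3, 4, 5} : Finset ℕ) := by decide
  have k5 := key 5 (by simp)
  have k4 := key 4 (by simp)
  have k3 := key 3 (by simp)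
  simp only [hIcc, Finset.sum_insert, Finset.sum_singleton, Finset.mem_insert,
    Finset.mem_singleton, Nat.reduceEqDiff, or_self, not_false_eq_true] at k5 k4 k3
  -- Modulo the largest entry the involution reverses the order of the other four.
  have e5 : ∀ c, 0 < c → c < a 5 →
      (if a 1 = c then m 1 else 0) + (if a 2 = c then m 2 else 0) +
        (if a 3 = c then m 3 else 0) + (if a 4 = c then m 4 else 0) =
      (if a 1 + c = a 5 then m 1 else 0) + (if a 2 + c = a 5 then m 2 else 0) +
        (if a 3 + c = a 5 then m 3 else 0) + (if a 4 + c = a 5 then m 4 else 0) := by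
    intro c hc hc'
    have := k5 c hc'
    rw [Nat.mod_eq_of_lt (show a 1 < a 5 by omega), Nat.mod_eq_of_lt (show a 2 < a 5 by omega),
      Nat.mod_eq_of_lt (show a 3 < a 5 by omega), Nat.mod_eq_of_lt h45, Nat.mod_self,
      Nat.add_mod_left, Nat.mod_eq_of_lt hc', if_neg hc.ne, if_neg hc.ne'] at this
    simp only [Nat.add_mod_eq_zero_iff_of_lt (show 0 < a 1 by omega) (show a 1 < a 5 by omega) hc',
      Nat.add_mod_eq_zero_iff_of_lt (show 0 < a 2 by omega) (show a 2 < a 5 by omega) hc',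
      Nat.add_mod_eq_zero_iff_of_lt (show 0 < a 3 by omega) (show a 3 < a 5 by omega) hc',
      Nat.add_mod_eq_zero_iff_of_lt (show 0 < a 4 by omega) (show a 4 < a 5 by omega) hc'] at this
    omega
  obtain ⟨s14, s23, m14, m23⟩ := reflection_four h0 h12 h23 h34 h45 m1 m2 m3 m4 e5
  -- Modulo the second largest entry, the largest and the smallest one coincide.
  have e4 : ∀ c, 0 < c → c < a 4 →
      (if a 1 = c then m 1 + m 5 else 0) + (if a 2 = c then m 2 else 0) +
        (if a 3 = c then m 3 else 0) =
      (if a 1 + c = a 4 then m 1 + m 5 else 0) + (if a 2 + c = a 4 then m 2 else 0) +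
        (if a 3 + c = a 4 then m 3 else 0) := by
    intro c hc hc'
    have := k4 c hc'
    rw [← s14, Nat.add_mod_right, Nat.mod_eq_of_lt (show a 1 < a 4 by omega),
      Nat.mod_eq_of_lt (show a 2 < a 4 by omega),
      Nat.mod_eq_of_lt h34, Nat.mod_self, Nat.add_right_comm (a 1) (a 4) c,
      Nat.add_mod_right, Nat.add_mod_left, Nat.mod_eq_of_lt hc', if_neg hc.ne, if_neg hc.ne'] at this
    simp only [Nat.add_mod_eq_zero_iff_of_lt (show 0 < a 1 by omega) (show a 1 < a 4 by omega) hc',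
      Nat.add_mod_eq_zero_iff_of_lt (show 0 < a 2 by omega) (show a 2 < a 4 by omega) hc',
      Nat.add_mod_eq_zero_iff_of_lt (show 0 < a 3 by omega) (show a 3 < a 4 by omega) hc'] at this
    split_ifs at this ⊢ <;> omega
  obtain ⟨s13, s22, m15⟩ := reflection_three h0 h12 h23 h34 (by omega) m2 m3 e4
  have b2 : a 2 = 2 * a 1 := by omega
  have b3 : a 3 = 3 * a 1 := by omega
  have b1 : a 1 = 1 := by
    suffices h : a 1 ∣ (Finset.Icc 1 5).gcd a from Nat.dvd_one.mp (h.trans hgcd.dvd)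
    refine Finset.dvd_gcd fun i hi => ?_
    simp only [hIcc, Finset.mem_insert, Finset.mem_singleton] at hi
    rcases hi with rfl | rfl | rfl | rfl | rfl
    · exact dvd_rfl
    · exact ⟨2, by omega⟩
    · exact ⟨3, by omega⟩
    · exact ⟨4, by omega⟩
    · exact ⟨5, by omega⟩
  have f := k3 1 (by omega)
  rw [b1, show a 2 = 2 by omega, show a 3 = 3 by omega, show a 4 = 4 by omega,
    show a 5 = 5 by omega] at f
  norm_num at f
  omega
end

section
/- Let N be a positive integer and let W be a finite multiset of positive integers whose set of distinct elements is {a_1,...,a_N} with a_1 < ... < a_N, where a_i occurs in W with multiplicity m_i ≥ 1. Assume gcd(a_1,...,a_N) = 1, and assume W ≡ -W (mod a_i) for every i in {1,...,N}. If N = 6, then m_2 = m_3 = m_4 = 2·m_1 = 2·m_5 = 2·m_6. -/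
/-- `ModSymm` in terms of the map `ℕ → ZMod d`. -/
lemma ModSymm.map_natCast_eq {W : Multiset ℕ} {d : ℕ} (h : ModSymm W d) :
    W.map (fun x : ℕ => (x : ZMod d)) = W.map (fun x : ℕ => -(x : ZMod d)) := by
  simpa [ModSymm, Multiset.bind_singleton] using h

/-- Every element of a multiset symmetric modulo `d` has a partner
such that the sum is divisible by `d`. -/
lemma ModSymm.exists_dvd_add {W : Multiset ℕ} {d x : ℕ} (h : ModSymm W d) (hx : x ∈ W) :
    ∃ y ∈ W, d ∣ x + y := by
  have hx' : (x : ZMod d) ∈ W.map (fun y : ℕ => -(y : ZMod d)) :=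
    h.map_natCast_eq ▸ Multiset.mem_map_of_mem (fun y : ℕ => (y : ZMod d)) hx
  obtain ⟨y, hy, hxy⟩ := Multiset.mem_map.1 hx'
  refine ⟨y, hy, (ZMod.natCast_eq_zero_iff _ _).1 ?_⟩
  rw [Nat.cast_add, ← hxy, neg_add_cancel]

/-- A multiset whose elements lie in `{1, …, 6}` is determined by its six multiplicities. -/
lemma eq_replicate_of_mem_Icc_one_six {W : Multiset ℕ} (h : ∀ x ∈ W, 1 ≤ x ∧ x ≤ 6) :
    W = .replicate (W.count 1) 1 + .replicate (W.count 2) 2 + .replicate (W.count 3) 3 +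
      .replicate (W.count 4) 4 + .replicate (W.count 5) 5 + .replicate (W.count 6) 6 := by
  ext x
  by_cases hx : 1 ≤ x ∧ x ≤ 6
  · obtain ⟨h1, h6⟩ := hx
    interval_cases x <;> simp [Multiset.count_replicate]
  · rw [Multiset.count_eq_zero_of_notMem fun hm => hx (h x hm)]
    simp only [Multiset.count_add, Multiset.count_replicate]
    repeat rw [if_neg (by omega)]

lemma Nat.eq_of_dvd_add_of_lt {d x y : ℕ} (hx : 0 < x) (hxd : x < d) (hy : y < d)
    (h : d ∣ x + y) : x + y = d := by
  obtain ⟨k, hk⟩ := h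
  have h0 : 0 < k := by
    rcases Nat.eq_zero_or_pos k with rfl | h0
    · omega
    · exact h0
  have h2 : k < 2 := by
    by_contra! h2
    nlinarith
  obtain rfl : k = 1 := by omega
  omega

/-- Six positive integers in increasing order whose set is symmetric modulo the two
largest ones are proportional to `1, …, 6`. -/
lemma eq_mul_of_modSymm {W : Multiset ℕ} {a b c d e f : ℕ} (ha : 0 < a) (hab : a < b)
    (hbc : b < c) (hcd : c < d) (hde : d < e) (hef : e < f)
    (hW : ∀ x, x ∈ W ↔ x = a ∨ x = b ∨ x = c ∨ x = d ∨ x = e ∨ x = f)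
    (he : ModSymm W e) (hf : ModSymm W f) :
    b = 2 * a ∧ c = 3 * a ∧ d = 4 * a ∧ e = 5 * a ∧ f = 6 * a := by
  have key : ∀ x ∈ W, x < f → x + a = f ∨ x + b = f ∨ x + c = f ∨ x + d = f ∨ x + e = f := by
    intro x hx hxf
    have hx0 : 0 < x := by have := (hW x).1 hx; omega
    obtain ⟨y, hy, hd⟩ := hf.exists_dvd_add hx
    rcases (hW y).1 hy with rfl | rfl | rfl | rfl | rfl | rfl
    on_goal 6 =>
      have := Nat.le_of_dvd hx0 ((Nat.dvd_add_left dvd_rfl).1 hd)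
      omega
    all_goals
      have := Nat.eq_of_dvd_add_of_lt hx0 hxf (by omega) hd
      simp [this]
  have k1 := key a ((hW a).2 (by simp)) (by omega)
  have k2 := key b ((hW b).2 (by simp)) (by omega)
  have k3 := key c ((hW c).2 (by simp)) (by omega)
  have k4 := key d ((hW d).2 (by simp)) (by omega)
  have k5 := key e ((hW e).2 (by simp)) (by omega)
  have s1 : a + e = f := by omega
  have s2 : b + d = f := by omega
  have s3 : c + c = f := by omega
  have key' : ∀ x ∈ W, x < e → x + a = e ∨ x + b = e ∨ x + c = e ∨ x + d = e := by
    intro x hx hxe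
    have hx0 : 0 < x := by have := (hW x).1 hx; omega
    obtain ⟨y, hy, hd⟩ := he.exists_dvd_add hx
    rcases (hW y).1 hy with h | h | h | h | h | h
    on_goal 5 =>
      subst h
      have := Nat.le_of_dvd hx0 ((Nat.dvd_add_left dvd_rfl).1 hd)
      omega
    on_goal 5 =>
      have hd' : e ∣ x + a := by
        rw [h, ← s1, ← add_assoc] at hd
        exact (Nat.dvd_add_left dvd_rfl).1 hd
      have := Nat.eq_of_dvd_add_of_lt hx0 hxe (by omega) hd'
      omega
    all_goals
      have := Nat.eq_of_dvd_add_of_lt hx0 hxe (by omega) hd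
      omega
  have l1 := key' a ((hW a).2 (by simp)) (by omega)
  have l2 := key' b ((hW b).2 (by simp)) (by omega)
  have l3 := key' c ((hW c).2 (by simp)) (by omega)
  have l4 := key' d ((hW d).2 (by simp)) (by omega)
  have t1 : a + d = e := by omega
  have t2 : b + c = e := by omega
  omega

/-- The multiplicities of a multiset supported on `{1, …, 6}` and symmetric modulo
`4`, `5` and `6`. -/
lemma count_eq_of_modSymm {W : Multiset ℕ} (h : ∀ x ∈ W, 1 ≤ x ∧ x ≤ 6)
    (h4 : ModSymm W 4) (h5 : ModSymm W 5) (h6 : ModSymm W 6) :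
    W.count 1 = W.count 5 ∧ W.count 2 = W.count 4 ∧ W.count 1 + W.count 6 = W.count 4 ∧
      W.count 2 = W.count 3 ∧ W.count 1 + W.count 5 = W.count 3 := by
  have hW := eq_replicate_of_mem_Icc_one_six h
  generalize W.count 1 = p, W.count 2 = q, W.count 3 = r, W.count 4 = s, W.count 5 = t,
    W.count 6 = u at hW ⊢
  subst hW
  have e1 := congrArg (Multiset.count 1) h6.map_natCast_eq
  have e2 := congrArg (Multiset.count 2) h6.map_natCast_eq
  have e3 := congrArg (Multiset.count 1) h5.map_natCast_eq
  have e4 := congrArg (Multiset.count 2) h5.map_natCast_eq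
  have e5 := congrArg (Multiset.count 1) h4.map_natCast_eq
  simp +decide [Multiset.count_replicate] at e1 e2 e3 e4 e5
  omega

/-- Lemma II, claim (5): if `N = 6` then `m 2 = m 3 = m 4 = 2 m 1 = 2 m 5 = 2 m 6`. -/
theorem stmt_6 (N : ℕ) (hN : 0 < N) (a m : ℕ → ℕ) (W : Multiset ℕ)
    (hpos : ∀ i ∈ Finset.Icc 1 N, 0 < a i)
    (hmono : ∀ i ∈ Finset.Icc 1 N, ∀ k ∈ Finset.Icc 1 N, i < k → a i < a k)
    (hmult : ∀ i ∈ Finset.Icc 1 N, 1 ≤ m i)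
    (hcount : ∀ i ∈ Finset.Icc 1 N, W.count (a i) = m i)
    (hmem : ∀ x ∈ W, ∃ i ∈ Finset.Icc 1 N, x = a i)
    (hgcd : (Finset.Icc 1 N).gcd a = 1)
    (hmod : ∀ i ∈ Finset.Icc 1 N, ModSymm W (a i))
    (hN6 : N = 6) :
    m 2 = m 3 ∧ m 3 = m 4 ∧ m 4 = 2 * m 1 ∧ 2 * m 1 = 2 * m 5 ∧ 2 * m 5 = 2 * m 6 := by
  subst hN6
  have hI : Finset.Icc 1 6 = ({1, 2, 3, 4, 5, 6} : Finset ℕ) := by decide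
  have hin : ∀ i ∈ Finset.Icc 1 6, a i ∈ W := fun i hi =>
    Multiset.count_pos.1 (by rw [hcount i hi]; exact hmult i hi)
  have hW : ∀ x, x ∈ W ↔ x = a 1 ∨ x = a 2 ∨ x = a 3 ∨ x = a 4 ∨ x = a 5 ∨ x = a 6 := by
    refine fun x => ⟨fun hx => ?_, ?_⟩
    · simpa [hI] using hmem x hx
    · rintro (rfl | rfl | rfl | rfl | rfl | rfl) <;> exact hin _ (by decide)
  obtain ⟨h2, h3, h4, h5, h6⟩ := eq_mul_of_modSymm (hpos 1 (by decide))
    (hmono 1 (by decide) 2 (by decide) (by decide)) (hmono 2 (by decide) 3 (by decide) (by decide))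
    (hmono 3 (by decide) 4 (by decide) (by decide)) (hmono 4 (by decide) 5 (by decide) (by decide))
    (hmono 5 (by decide) 6 (by decide) (by decide)) hW (hmod 5 (by decide)) (hmod 6 (by decide))
  have h1 : a 1 = 1 := by
    refine Nat.dvd_one.1 ((Finset.dvd_gcd fun i hi => ?_).trans hgcd.dvd)
    rw [hI] at hi
    simp only [Finset.mem_insert, Finset.mem_singleton] at hi
    rcases hi with rfl | rfl | rfl | rfl | rfl | rfl <;> simp [*]
  simp only [h1, mul_one] at h2 h3 h4 h5 h6
  have := count_eq_of_modSymm (W := W) (fun x hx => by have := (hW x).1 hx; omega)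
    (h4 ▸ hmod 4 (by decide)) (h5 ▸ hmod 5 (by decide)) (h6 ▸ hmod 6 (by decide))
  have c1 := hcount 1 (by decide)
  have c2 := hcount 2 (by decide)
  have c3 := hcount 3 (by decide)
  have c4 := hcount 4 (by decide)
  have c5 := hcount 5 (by decide)
  have c6 := hcount 6 (by decide)
  rw [h1] at c1
  rw [h2] at c2
  rw [h3] at c3
  rw [h4] at c4
  rw [h5] at c5
  rw [h6] at c6
  omega
end

section
/- Let N be a positive integer and let W be a finite multiset of positive integers whose set of distinct elements is {a_1,...,a_N} with a_1 < ... < a_N, where a_i occurs in W with multiplicity m_i ≥ 1. Assume gcd(a_1,...,a_N) = 1, and assume W ≡ -W (mod a_i) for every i in {1,...,N}. Then N ≤ 6. -/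
theorem Multiset.countP_eq_sum_count {α : Type*} [DecidableEq α] {W : Multiset α} {p : α → Prop}
    [DecidablePred p] {s : Finset α} (h : ∀ x ∈ W, p x ↔ x ∈ s) :
    W.countP p = ∑ x ∈ s, W.count x := by
  rw [Multiset.countP_eq_card_filter, ← Multiset.sum_count_eq_card (s := s)]
  · refine Finset.sum_congr rfl fun x hx => ?_
    by_cases hxW : x ∈ W
    · exact Multiset.count_filter_of_pos ((h x hxW).2 hx)
    · rw [Multiset.count_eq_zero_of_notMem hxW, Multiset.count_eq_zero_of_notMem]
      exact fun hx' => hxW (Multiset.mem_of_mem_filter hx')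
  · intro x hx
    rw [Multiset.mem_filter] at hx
    exact (h x hx.1).1 hx.2

namespace ModSymm

variable {W : Multiset ℕ} {d : ℕ}

theorem countP_eq (h : ModSymm W d) (r : ℕ) :
    W.countP (fun x => x ≡ r [MOD d]) = W.countP (fun x => d ∣ x + r) := by
  have hmap : W.map (Nat.cast : ℕ → ZMod d) = W.map fun x : ℕ => -(x : ZMod d) := by
    simpa [ModSymm, Multiset.bind_def, Multiset.pure_def, Multiset.bind_singleton] using h
  have hcount := congrArg (Multiset.count (r : ZMod d)) hmap
  rw [Multiset.count_map, Multiset.count_map, ← Multiset.countP_eq_card_filter,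
    ← Multiset.countP_eq_card_filter] at hcount
  simpa only [eq_comm (a := (r : ZMod d)), ZMod.natCast_eq_natCast_iff,
    neg_eq_iff_add_eq_zero, ← Nat.cast_add, ZMod.natCast_eq_zero_iff] using hcount

theorem exists_dvd_add_s7 (h : ModSymm W d) {x : ℕ} (hx : x ∈ W) : ∃ y ∈ W, d ∣ y + x := by
  rw [← Multiset.countP_pos, ← h.countP_eq x, Multiset.countP_pos]
  exact ⟨x, hx, rfl⟩

theorem sum_count_eq (h : ModSymm W d) (r : ℕ) {s t : Finset ℕ}
    (hs : ∀ x ∈ W, x ≡ r [MOD d] ↔ x ∈ s) (ht : ∀ x ∈ W, d ∣ x + r ↔ x ∈ t) :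
    ∑ x ∈ s, W.count x = ∑ x ∈ t, W.count x := by
  rw [← Multiset.countP_eq_sum_count hs, ← Multiset.countP_eq_sum_count ht, h.countP_eq r]

end ModSymm

theorem Nat.eq_of_dvd_of_lt_two_mul_of_pos {d n : ℕ} (h : d ∣ n) (h0 : 0 < n) (h2 : n < 2 * d) :
    n = d := by
  obtain ⟨k, rfl⟩ := h
  have hk : k < 2 := by
    by_contra! hk
    nlinarith
  have hk0 : k ≠ 0 := by rintro rfl; simp at h0
  obtain rfl : k = 1 := by omega
  simp

/-- If `W` is symmetric modulo each of its elements, then its support is closed under subtracting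
the smallest element. -/
theorem sub_min_mem {W : Multiset ℕ} {s M : ℕ} (hs : s ∈ W) (hM : M ∈ W)
    (hs0 : 0 < s) (hmin : ∀ x ∈ W, s ≤ x) (hmax : ∀ x ∈ W, x ≤ M)
    (hmod : ∀ x ∈ W, ModSymm W x) {x : ℕ} (hx : x ∈ W) (hsx : s < x) : x - s ∈ W := by
  have hrefl : ∀ x ∈ W, x < M → M - x ∈ W := by
    intro x hx hxM
    obtain ⟨y, hy, hdvd⟩ := (hmod M hM).exists_dvd_add_s7 hx
    have := hmin x hx
    have := hmax y hy
    have := Nat.eq_of_dvd_of_lt_two_mul_of_pos hdvd (by omega) (by omega)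
    obtain rfl : y = M - x := by omega
    exact hy
  have hsM : s < M := hsx.trans_le (hmax x hx)
  have hP : M - s ∈ W := hrefl s hs hsM
  have hle : ∀ x ∈ W, x < M → x ≤ M - s := by
    intro x hx hxM
    have := hmin _ (hrefl x hx hxM)
    omega
  have hrefl' : ∀ x ∈ W, x < M - s → M - s - x ∈ W := by
    intro x hx hxP
    obtain ⟨y, hy, hdvd⟩ := (hmod _ hP).exists_dvd_add_s7 hx
    have := hmin x hx
    have := hmin y hy
    rcases (hmax y hy).lt_or_eq with hyM | rfl
    · have := hle y hy hyM
      have := Nat.eq_of_dvd_of_lt_two_mul_of_pos hdvd (by omega) (by omega)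
      obtain rfl : y = M - s - x := by omega
      exact hy
    · have hdvd' : y - s ∣ x + s := by
        rw [← Nat.dvd_add_right (dvd_refl (y - s))]
        convert hdvd using 1
        omega
      have := Nat.eq_of_dvd_of_lt_two_mul_of_pos hdvd' (by omega) (by omega)
      rwa [show y - s - x = s by omega]
  rcases (hmax x hx).lt_or_eq with hxM | rfl
  · have := hrefl' _ (hrefl x hx hxM) (by omega)
    convert this using 1
    omega
  · exact hP

/-- Closure of a set of positive integers with minimum `s` under subtracting `s`. -/
theorem dvd_and_mul_mem_of_sub_mem {S : Set ℕ} {s : ℕ} (hs0 : 0 < s) (hmin : ∀ x ∈ S, s ≤ x)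
    (hsub : ∀ x ∈ S, s < x → x - s ∈ S) :
    ∀ x ∈ S, s ∣ x ∧ ∀ j ∈ Finset.Icc 1 x, s ∣ j → j ∈ S := by
  intro x
  induction x using Nat.strong_induction_on with
  | _ x ih =>
    intro hx
    rcases (hmin x hx).eq_or_lt with rfl | hlt
    · refine ⟨dvd_rfl, fun j hj hdvd => ?_⟩
      rw [Finset.mem_Icc] at hj
      rwa [hj.2.antisymm (Nat.le_of_dvd hj.1 hdvd)]
    · obtain ⟨h1, h2⟩ := ih (x - s) (by omega) (hsub x hx hlt)
      have hdx : s ∣ x := by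
        have := h1.add (dvd_refl s)
        rwa [Nat.sub_add_cancel hlt.le] at this
      refine ⟨hdx, fun j hj hdvd => ?_⟩
      rw [Finset.mem_Icc] at hj
      rcases hj.2.eq_or_lt with rfl | hjx
      · exact hx
      · have := Nat.le_of_dvd (by omega) (Nat.dvd_sub hdx hdvd)
        exact h2 j (Finset.mem_Icc.2 ⟨hj.1, by omega⟩) hdvd

/-- Finding the support to be `{1, …, N}`, the multiplicities force `N ≤ 6`. -/
theorem le_six_of_mem_iff {W : Multiset ℕ} {N : ℕ} (hW : ∀ x, x ∈ W ↔ x ∈ Finset.Icc 1 N)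
    (hmod : ∀ x ∈ W, ModSymm W x) : N ≤ 6 := by
  by_contra! hN
  have hbd : ∀ x ∈ W, 1 ≤ x ∧ x ≤ N := fun x hx => Finset.mem_Icc.1 ((hW x).1 hx)
  have hmem : ∀ x, 1 ≤ x → x ≤ N → x ∈ W := fun x h1 h2 => (hW x).2 (Finset.mem_Icc.2 ⟨h1, h2⟩)
  have hdvd_iff : ∀ {d n k : ℕ}, 0 < n → n < 2 * d → k = d → (d ∣ n ↔ n = k) := by
    rintro d n _ h0 h2 rfl
    exact ⟨fun h => Nat.eq_of_dvd_of_lt_two_mul_of_pos h h0 h2, fun h => h ▸ dvd_rfl⟩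
  have hmod_iff : ∀ {d x r : ℕ}, r < d → x < r + 2 * d →
      (x ≡ r [MOD d] ↔ x = r ∨ x = r + d) := by
    intro d x r hr hx
    constructor
    · intro h
      rw [Nat.ModEq, Nat.mod_eq_of_lt hr] at h
      have h1 := Nat.div_add_mod x d
      have h2 : x / d < 2 := by
        by_contra! h2
        nlinarith
      rw [h] at h1
      interval_cases x / d <;> omega
    · rintro (rfl | rfl) <;> simp [Nat.ModEq]
  have h1 : ∀ j, 1 ≤ j → j < N → W.count j = W.count (N - j) := by
    intro j hj hjN
    have := (hmod N (hmem N (by omega) le_rfl)).sum_count_eq j (s := {j}) (t := {N - j}) ?_ ?_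
    · simpa using this
    · intro x hx
      have := hbd x hx
      rw [hmod_iff (by omega) (by omega), Finset.mem_singleton]
      omega
    · intro x hx
      have := hbd x hx
      rw [hdvd_iff (by omega) (by omega) rfl, Finset.mem_singleton]
      omega
  have h2 : ∀ j, 2 ≤ j → j ≤ N - 3 → W.count j = W.count (N - 1 - j) := by
    intro j hj hjN
    have := (hmod (N - 1) (hmem _ (by omega) (by omega))).sum_count_eq j
      (s := {j}) (t := {N - 1 - j}) ?_ ?_
    · simpa using this
    · intro x hx
      have := hbd x hx
      rw [hmod_iff (by omega) (by omega), Finset.mem_singleton]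
      omega
    · intro x hx
      have := hbd x hx
      rw [hdvd_iff (by omega) (by omega) rfl, Finset.mem_singleton]
      omega
  have h3 : W.count 2 + W.count N = W.count (N - 4) := by
    have := (hmod (N - 2) (hmem _ (by omega) (by omega))).sum_count_eq 2
      (s := {2, N}) (t := {N - 4}) ?_ ?_
    · rwa [Finset.sum_pair (by omega), Finset.sum_singleton] at this
    · intro x hx
      have := hbd x hx
      rw [hmod_iff (by omega) (by omega), Finset.mem_insert, Finset.mem_singleton]
      omega
    · intro x hx
      have := hbd x hx
      rw [hdvd_iff (by omega) (by omega) rfl, Finset.mem_singleton]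
      omega
  have h4 : ∀ j, 2 ≤ j → j ≤ N - 2 → W.count j = W.count 2 := by
    intro j hj
    induction j, hj using Nat.le_induction with
    | base => simp
    | succ j hj ih =>
      intro hjN
      rw [← ih (by omega), h1 (j + 1) (by omega) (by omega), h2 j hj (by omega)]
      congr 1
      omega
  have h5 := h4 (N - 4) (by omega) (by omega)
  have h6 := Multiset.count_pos.2 (hmem N (by omega) le_rfl)
  omega

/-- Lemma II, claim (6): under the stated hypotheses, `N ≤ 6`. -/
theorem stmt_7 (N : ℕ) (hN : 0 < N) (a m : ℕ → ℕ) (W : Multiset ℕ)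
    (hpos : ∀ i ∈ Finset.Icc 1 N, 0 < a i)
    (hmono : ∀ i ∈ Finset.Icc 1 N, ∀ k ∈ Finset.Icc 1 N, i < k → a i < a k)
    (hmult : ∀ i ∈ Finset.Icc 1 N, 1 ≤ m i)
    (hcount : ∀ i ∈ Finset.Icc 1 N, W.count (a i) = m i)
    (hmem : ∀ x ∈ W, ∃ i ∈ Finset.Icc 1 N, x = a i)
    (hgcd : (Finset.Icc 1 N).gcd a = 1)
    (hmod : ∀ i ∈ Finset.Icc 1 N, ModSymm W (a i)) :
    N ≤ 6 := by
  have hW : ∀ x, x ∈ W ↔ ∃ i ∈ Finset.Icc 1 N, a i = x := by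
    refine fun x => ⟨fun hx => ?_, ?_⟩
    · obtain ⟨i, hi, rfl⟩ := hmem x hx
      exact ⟨i, hi, rfl⟩
    · rintro ⟨i, hi, rfl⟩
      rw [← Multiset.one_le_count_iff_mem, hcount i hi]
      exact hmult i hi
  have hWmod : ∀ x ∈ W, ModSymm W x := by
    intro x hx
    obtain ⟨i, hi, rfl⟩ := hmem x hx
    exact hmod i hi
  have hmono' : StrictMonoOn a (Finset.Icc 1 N : Finset ℕ) := fun i hi k hk hik =>
    hmono i hi k hk hik
  have h1N : 1 ∈ Finset.Icc 1 N := Finset.mem_Icc.2 ⟨le_rfl, hN⟩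
  have hNN : N ∈ Finset.Icc 1 N := Finset.mem_Icc.2 ⟨hN, le_rfl⟩
  have hmin : ∀ x ∈ W, a 1 ≤ x := by
    intro x hx
    obtain ⟨i, hi, rfl⟩ := hmem x hx
    exact hmono'.monotoneOn h1N hi (Finset.mem_Icc.1 hi).1
  have hmax : ∀ x ∈ W, x ≤ a N := by
    intro x hx
    obtain ⟨i, hi, rfl⟩ := hmem x hx
    exact hmono'.monotoneOn hi hNN (Finset.mem_Icc.1 hi).2
  have hsW : a 1 ∈ W := (hW _).2 ⟨1, h1N, rfl⟩
  have hMW : a N ∈ W := (hW _).2 ⟨N, hNN, rfl⟩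
  have key := dvd_and_mul_mem_of_sub_mem (S := {x | x ∈ W}) (hpos 1 h1N) hmin
    fun x hx hsx => sub_min_mem hsW hMW (hpos 1 h1N) hmin hmax hWmod hx hsx
  have hone : a 1 = 1 := by
    have hdvd : a 1 ∣ (Finset.Icc 1 N).gcd a :=
      Finset.dvd_gcd fun i hi => (key (a i) ((hW _).2 ⟨i, hi, rfl⟩)).1
    rwa [hgcd, Nat.dvd_one] at hdvd
  have hsupp : ∀ x, x ∈ W ↔ x ∈ Finset.Icc 1 (a N) := fun x =>
    ⟨fun hx => Finset.mem_Icc.2 ⟨hone ▸ hmin x hx, hmax x hx⟩,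
      fun hx => (key (a N) hMW).2 x hx (by simp [hone])⟩
  have himage : (Finset.Icc 1 N).image a = Finset.Icc 1 (a N) := by
    ext x
    rw [← hsupp, hW, Finset.mem_image]
  have hcard : N = a N := by
    have := Finset.card_image_of_injOn hmono'.injOn
    rw [himage] at this
    simpa using this.symm
  rw [hcard]
  exact le_six_of_mem_iff hsupp hWmod
end

section
/- Let N > 3 be an integer and let W be a finite multiset of positive integers whose set of distinct elements is exactly {1,2,...,N}, where the value i occurs in W with multiplicity m_i ≥ 1. If W ≡ -W (mod N-1), then m_1 + m_N = m_{N-2} and m_i = m_{N-i-1} for every i in {2,...,N-3}. -/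
theorem ModSymm.card_filter_eq {W : Multiset ℕ} {d : ℕ} (h : ModSymm W d) (r : ℕ) :
    (W.filter fun x : ℕ => (d : ℤ) ∣ (x : ℤ) - r).card = (W.filter fun x => d ∣ r + x).card := by
  have hW : W.map (fun x : ℕ => (x : ZMod d)) = W.map (fun x : ℕ => -(x : ZMod d)) := by
    simpa [ModSymm, Multiset.map_bind, Multiset.bind_map, Multiset.pure_def,
      Multiset.bind_singleton] using h
  have key := congrArg (Multiset.count (r : ZMod d)) hW
  rw [Multiset.count_map, Multiset.count_map] at key
  convert key using 4 with x x
  · rw [← ZMod.intCast_eq_intCast_iff_dvd_sub]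
    simp
  · rw [← ZMod.natCast_eq_zero_iff, Nat.cast_add, eq_neg_iff_add_eq_zero]

theorem Multiset.card_filter_eq_count_of_forall {W : Multiset ℕ} {p : ℕ → Prop} [DecidablePred p]
    (a : ℕ) (h : ∀ x ∈ W, p x ↔ x = a) : (W.filter p).card = W.count a := by
  rw [Multiset.filter_congr h, Multiset.filter_eq', Multiset.card_replicate]

theorem Int.natCast_dvd_natCast_sub_iff_eq {N x r : ℕ} (hx : x ∈ Finset.Icc 1 N)
    (hr : 2 ≤ r) (hrN : r ≤ N - 2) : ((N - 1 : ℕ) : ℤ) ∣ x - r ↔ x = r := by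
  rw [Finset.mem_Icc] at hx
  refine ⟨fun h => ?_, fun h => by simp [h]⟩
  have := Int.eq_zero_of_abs_lt_dvd h (by rw [abs_lt]; omega)
  omega

theorem Nat.pred_dvd_add_iff {N x r : ℕ} (hx : x ∈ Finset.Icc 1 N) (hr : 2 ≤ r)
    (hrN : r ≤ N - 2) : N - 1 ∣ r + x ↔ r + x = N - 1 ∨ r + x = 2 * (N - 1) := by
  rw [Finset.mem_Icc] at hx
  constructor
  · rintro ⟨k, hk⟩
    have h0 : 0 < k := by
      rcases Nat.eq_zero_or_pos k with rfl | h
      · omega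
      · exact h
    have h3 : k < 3 := by
      by_contra! h
      have := Nat.mul_le_mul_left (N - 1) h
      omega
    interval_cases k <;> omega
  · rintro (h | h)
    · exact ⟨1, by omega⟩
    · exact ⟨2, by omega⟩

/-- Equation (A.2) in the proof of Lemma II: if `N > 3`, the distinct elements
of `W` are exactly `{1, ..., N}` with multiplicities `m i ≥ 1`, and
`W ≡ -W (mod N-1)`, then `m 1 + m N = m (N - 2)` and `m i = m (N - i - 1)` for
all `i ∈ {2, ..., N-3}`. -/
theorem stmt_9 (N : ℕ) (hN : 3 < N) (m : ℕ → ℕ) (W : Multiset ℕ)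
    (hmult : ∀ i ∈ Finset.Icc 1 N, 1 ≤ m i)
    (hcount : ∀ i ∈ Finset.Icc 1 N, W.count i = m i)
    (hmem : ∀ x ∈ W, x ∈ Finset.Icc 1 N)
    (hmod : ModSymm W (N - 1)) :
    m 1 + m N = m (N - 2) ∧ ∀ i ∈ Finset.Icc 2 (N - 3), m i = m (N - i - 1) := by
  have key (r : ℕ) (hr : 2 ≤ r) (hrN : r ≤ N - 2) :
      m r = (W.filter fun x => N - 1 ∣ r + x).card := by
    rw [← hmod.card_filter_eq r, ← hcount r (by rw [Finset.mem_Icc]; omega)]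
    exact (Multiset.card_filter_eq_count_of_forall r fun x hx =>
      Int.natCast_dvd_natCast_sub_iff_eq (hmem x hx) hr hrN).symm
  constructor
  · rw [key (N - 2) (by omega) le_rfl, ← hcount 1 (by rw [Finset.mem_Icc]; omega),
      ← hcount N (by rw [Finset.mem_Icc]; omega),
      Multiset.filter_congr (q := fun x => x = 1 ∨ x = N) fun x hx => by
        rw [Nat.pred_dvd_add_iff (hmem x hx) (by omega) le_rfl]
        omega,
      ← Multiset.card_filter_eq_count_of_forall (p := (· = 1)) 1 fun _ _ => Iff.rfl,
      ← Multiset.card_filter_eq_count_of_forall (p := (· = N)) N fun _ _ => Iff.rfl,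
      ← Multiset.card_add, Multiset.filter_add_filter]
    rw [Multiset.card_add, (Multiset.filter_eq_nil (p := fun x => x = 1 ∧ x = N)).mpr]
    · simp
    · intro x _
      omega
  · intro i hi
    rw [Finset.mem_Icc] at hi
    rw [key i hi.1 (by omega), ← hcount (N - i - 1) (by rw [Finset.mem_Icc]; omega)]
    refine Multiset.card_filter_eq_count_of_forall _ fun x hx => ?_
    have := Finset.mem_Icc.mp (hmem x hx)
    rw [Nat.pred_dvd_add_iff (hmem x hx) hi.1 (by omega)]
    omega
end
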